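/- arXiv:2504.00257 — 4 statements merged into one kernel-verified Lean document; each statement's English description precedes it below -/
import Mathlib

section
/- Let K ⊆ ℝⁿ be a convex set and let f_1,…,f_m : ℝⁿ → ℝ be convex functions. Then a point x* ∈ K is a weakly Pareto point of the multiobjective problem min_{x∈K} (f_1(x),…,f_m(x)) if and only if there exists a weight vector w ∈ Δ^{m−1} such that x* is a global minimizer over K of the scalarized function f_w(x) = w_1 f_1(x) + ⋯ + w_m f_m(x). -/
/-- The upper closure of the image of a convex set under a family of convex functions is convex. -/
theorem convex_setOf_exists_forall_le {E ι : Type*} [AddCommGroup E] [Module ℝ E]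
    {K : Set E} {f : ι → E → ℝ} (hK : Convex ℝ K) (hf : ∀ i, ConvexOn ℝ K (f i)) :
    Convex ℝ {y : ι → ℝ | ∃ x ∈ K, ∀ i, f i x ≤ y i} := by
  rintro y ⟨x, hx, hxy⟩ y' ⟨x', hx', hxy'⟩ a b ha hb hab
  refine ⟨a • x + b • x', hK hx hx' ha hb hab, fun i => ?_⟩
  calc f i (a • x + b • x') ≤ a • f i x + b • f i x' := (hf i).2 hx hx' ha hb hab
    _ ≤ a • y i + b • y' i := by
      gcongr
      · exact hxy i
      · exact hxy' i

/-- If no point of a convex set strictly improves all of finitely many convex functions at `xs`,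
then `xs` minimizes some convex combination of these functions. -/
theorem exists_weights_of_not_exists_forall_lt {E ι : Type*} [AddCommGroup E] [Module ℝ E]
    [Fintype ι] {K : Set E} {f : ι → E → ℝ} (hK : Convex ℝ K) (hf : ∀ i, ConvexOn ℝ K (f i))
    {xs : E} (hxs : xs ∈ K) (h : ¬ ∃ x ∈ K, ∀ i, f i x < f i xs) :
    ∃ w : ι → ℝ, (∀ i, 0 ≤ w i) ∧ ∑ i, w i = 1 ∧
      ∀ x ∈ K, ∑ i, w i * f i xs ≤ ∑ i, w i * f i x := by
  classical
  set N : Set (ι → ℝ) := Set.univ.pi fun i => Set.Iio (f i xs)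
  have hN : IsOpen N := isOpen_set_pi Set.finite_univ fun _ _ => isOpen_Iio
  have hNc : Convex ℝ N := convex_pi fun _ _ => convex_Iio _
  have hdisj : Disjoint N {y | ∃ x ∈ K, ∀ i, f i x ≤ y i} := by
    rw [Set.disjoint_left]
    rintro y hy ⟨x, hx, hxy⟩
    exact h ⟨x, hx, fun i => (hxy i).trans_lt (hy i trivial)⟩
  obtain ⟨g, u, hgN, hgA⟩ :=
    geometric_hahn_banach_open hNc hN (convex_setOf_exists_forall_le hK hf) hdisj
  set c : ι → ℝ := fun i => g (Pi.single i 1)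
  have hg (y : ι → ℝ) : g y = ∑ i, c i * y i := by
    conv_lhs => rw [pi_eq_sum_univ' y]
    simp [c, mul_comm]
  set p : ι → ℝ := fun i => f i xs
  have hp : u ≤ g p := hgA p ⟨xs, hxs, fun _ => le_rfl⟩
  have hlt {ε : ℝ} (hε : 0 < ε) : g p - ε * g 1 < u := by
    have := hgN (p - ε • 1) fun i _ => by simp [p, hε]
    simpa using this
  have hg1 : 0 < g 1 := by linarith [hlt one_pos]
  have hgp : g p ≤ u := by
    by_contra! hu
    have := hlt (div_pos (sub_pos.2 hu) hg1)
    rw [div_mul_cancel₀ _ hg1.ne'] at this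
    linarith
  have hc (i : ι) : 0 ≤ c i := by
    by_contra! hci
    have ht : 0 ≤ (u - 1 - g p) / c i := div_nonneg_of_nonpos (by linarith) hci.le
    have := hgA (p + ((u - 1 - g p) / c i) • Pi.single i 1) ⟨xs, hxs, fun j => by
      have : (0 : ℝ) ≤ (Pi.single i 1 : ι → ℝ) j := by
        rw [Pi.single_apply]; split_ifs <;> norm_num
      simpa [p] using mul_nonneg ht this⟩
    rw [map_add, map_smul, smul_eq_mul, div_mul_cancel₀ _ hci.ne] at this
    linarith
  refine ⟨fun i => c i / g 1, fun i => div_nonneg (hc i) hg1.le, ?_, fun x hx => ?_⟩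
  · rw [← Finset.sum_div, div_eq_one_iff_eq hg1.ne', hg 1]
    simp
  · simp only [div_mul_eq_mul_div, ← Finset.sum_div]
    refine div_le_div_of_nonneg_right ?_ hg1.le
    have := hgp.trans (hgA (fun i => f i x) ⟨x, hx, fun _ => le_rfl⟩)
    rwa [hg, hg] at this

/-- For a convex multiobjective problem, a feasible point is a weakly Pareto point
if and only if it minimizes some linear scalarization with weights in the simplex. -/
theorem weakly_pareto_iff_scalarization {n m : ℕ}
    (K : Set (Fin n → ℝ)) (hK : Convex ℝ K)
    (f : Fin m → (Fin n → ℝ) → ℝ)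
    (hf : ∀ i, ConvexOn ℝ Set.univ (f i))
    (xs : Fin n → ℝ) (hxs : xs ∈ K) :
    (¬ ∃ x ∈ K, ∀ i, f i x < f i xs) ↔
      ∃ w : Fin m → ℝ, (∀ i, 0 ≤ w i) ∧ (∑ i, w i) = 1 ∧
        ∀ x ∈ K, (∑ i, w i * f i xs) ≤ ∑ i, w i * f i x := by
  refine ⟨exists_weights_of_not_exists_forall_lt hK
    (fun i => (hf i).subset (Set.subset_univ K) hK) hxs, ?_⟩
  rintro ⟨w, hw, hw1, hmin⟩ ⟨x, hx, hlt⟩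
  obtain ⟨i, -, hi⟩ : ∃ i ∈ Finset.univ, 0 < w i :=
    Finset.exists_lt_of_sum_lt (by simp [hw1])
  refine (hmin x hx).not_gt (Finset.sum_lt_sum (fun j _ => ?_) ⟨i, Finset.mem_univ i, ?_⟩)
  · exact mul_le_mul_of_nonneg_left (hlt j).le (hw j)
  · exact mul_lt_mul_of_pos_left (hlt i) hi
end

section
/- Let c_1,…,c_l : ℝⁿ → ℝ and f_1,…,f_m : ℝⁿ → ℝ all be continuous, and let K = {x ∈ ℝⁿ : c_1(x) ≥ 0, …, c_l(x) ≥ 0}. Then the weakly Pareto set 𝒲𝒫 = {x* ∈ K : x* is a weakly Pareto point of min_{x∈K} (f_1(x),…,f_m(x))} is a closed subset of ℝⁿ. -/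
/-- If all constraint functions and objectives are continuous, the weakly Pareto set
of the multiobjective problem over `K = {x | c i x ≥ 0}` is closed. -/
theorem weakly_pareto_set_closed {n m l : ℕ}
    (c : Fin l → (Fin n → ℝ) → ℝ) (hc : ∀ i, Continuous (c i))
    (f : Fin m → (Fin n → ℝ) → ℝ) (hf : ∀ j, Continuous (f j)) :
    IsClosed {xs : Fin n → ℝ |
      (∀ i, 0 ≤ c i xs) ∧
      ¬ ∃ x : Fin n → ℝ, (∀ i, 0 ≤ c i x) ∧ ∀ j, f j x < f j xs} := by
  simp only [not_exists, not_and, Set.ofPred_and, Set.ofPred_forall]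
  refine (isClosed_iInter fun i => isClosed_le continuous_const (hc i)).inter
    (isClosed_iInter fun x => isClosed_iInter fun _ => ?_)
  rw [← isOpen_compl_iff]
  simp only [Set.compl_ofPred, not_not, Set.ofPred_forall]
  exact isOpen_iInter_of_finite fun j => isOpen_lt continuous_const (hf j)
end

section
/- Let f : ℝⁿ → ℝ be a convex differentiable function, let c_1,…,c_l : ℝⁿ → ℝ be concave differentiable functions, and let K = {x ∈ ℝⁿ : c_1(x) ≥ 0, …, c_l(x) ≥ 0}. Suppose x* ∈ K and λ = (λ_1,…,λ_l) ∈ ℝ^l satisfy: λ_i ≥ 0 for all i, λ_i · c_i(x*) = 0 for all i, and ∇f(x*) = λ_1 ∇c_1(x*) + ⋯ + λ_l ∇c_l(x*). Then x* is a global minimizer of f over K, i.e., f(x*) ≤ f(x) for all x ∈ K. -/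
/-- The gradient of `g : ℝⁿ → ℝ` at `x`: the vector of partial derivatives. -/
noncomputable def grad {n : ℕ} (g : (Fin n → ℝ) → ℝ) (x : Fin n → ℝ) : Fin n → ℝ :=
  fun i => fderiv ℝ g x (Pi.single i 1)

/-- A convex function lies above its tangent plane at any point of differentiability. -/
theorem ConvexOn.add_fderiv_sub_le {E : Type*} [NormedAddCommGroup E] [NormedSpace ℝ E]
    {s : Set E} {f : E → ℝ} (hf : ConvexOn ℝ s f) {x y : E} (hx : x ∈ s) (hy : y ∈ s)
    (hd : DifferentiableAt ℝ f x) : f x + fderiv ℝ f x (y - x) ≤ f y := by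
  have hconv := hf.comp_affineMap (AffineMap.lineMap x y : ℝ →ᵃ[ℝ] E)
  have hd' : HasFDerivAt f (fderiv ℝ f x) (AffineMap.lineMap x y (0 : ℝ)) := by
    simpa using hd.hasFDerivAt
  have hderiv : HasDerivAt (f ∘ (AffineMap.lineMap x y : ℝ →ᵃ[ℝ] E))
      (fderiv ℝ f x (y - x)) 0 :=
    hd'.comp_hasDerivAt (0 : ℝ) AffineMap.hasDerivAt_lineMap
  have h := hconv.le_slope_of_hasDerivAt (x := 0) (y := 1) (by simpa using hx)
    (by simpa using hy) one_pos hderiv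
  simp only [slope_def_field, Function.comp_apply, AffineMap.lineMap_apply_one,
    AffineMap.lineMap_apply_zero, sub_zero, div_one] at h
  linarith

/-- A concave function lies below its tangent plane at any point of differentiability. -/
theorem ConcaveOn.le_add_fderiv_sub {E : Type*} [NormedAddCommGroup E] [NormedSpace ℝ E]
    {s : Set E} {f : E → ℝ} (hf : ConcaveOn ℝ s f) {x y : E} (hx : x ∈ s) (hy : y ∈ s)
    (hd : DifferentiableAt ℝ f x) : f y ≤ f x + fderiv ℝ f x (y - x) := by
  have h := hf.neg.add_fderiv_sub_le hx hy hd.neg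
  simp only [fderiv_neg, Pi.neg_apply, neg_apply] at h
  linarith

theorem fderiv_apply_eq_dotProduct_grad {n : ℕ} (g : (Fin n → ℝ) → ℝ) (x v : Fin n → ℝ) :
    fderiv ℝ g x v = v ⬝ᵥ grad g x := by
  conv_lhs => rw [pi_eq_sum_univ' v, map_sum]
  simp [dotProduct, grad]

/-- The KKT conditions are sufficient for global optimality of a convex differentiable
function over a feasible set defined by concave differentiable inequality constraints. -/
theorem kkt_sufficient_for_convex {n l : ℕ}
    (f : (Fin n → ℝ) → ℝ) (hf : ConvexOn ℝ Set.univ f) (hfd : Differentiable ℝ f)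
    (c : Fin l → (Fin n → ℝ) → ℝ)
    (hc : ∀ i, ConcaveOn ℝ Set.univ (c i)) (hcd : ∀ i, Differentiable ℝ (c i))
    (xs : Fin n → ℝ) (hxs : ∀ i, 0 ≤ c i xs)
    (lam : Fin l → ℝ) (hlam : ∀ i, 0 ≤ lam i)
    (hcomp : ∀ i, lam i * c i xs = 0)
    (hstat : grad f xs = ∑ i, lam i • grad (c i) xs) :
    ∀ x : Fin n → ℝ, (∀ i, 0 ≤ c i x) → f xs ≤ f x := by
  intro x hx
  have hgrad : fderiv ℝ f xs (x - xs) = ∑ i, lam i * fderiv ℝ (c i) xs (x - xs) := by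
    simp only [fderiv_apply_eq_dotProduct_grad, hstat, dotProduct_sum, dotProduct_smul,
      smul_eq_mul]
  have hnonneg : 0 ≤ fderiv ℝ f xs (x - xs) := by
    rw [hgrad]
    refine Finset.sum_nonneg fun i _ => ?_
    have h := mul_le_mul_of_nonneg_left
      ((hc i).le_add_fderiv_sub (Set.mem_univ xs) (Set.mem_univ x) (hcd i xs)) (hlam i)
    rw [mul_add, hcomp i, zero_add] at h
    exact (mul_nonneg (hlam i) (hx i)).trans h
  linarith [hf.add_fderiv_sub_le (Set.mem_univ xs) (Set.mem_univ x) (hfd xs)]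
end

section
/- Let h : ℝⁿ → ℝ be differentiable, let d_1,…,d_m ∈ ℝⁿ be linearly independent vectors, define f_j(x) = h(x) + d_jᵀx for j = 1,…,m, and let c_1,…,c_l : ℝⁿ → ℝ be differentiable. Let D be the (n+1)×m real matrix whose j-th column is (d_j, 1) ∈ ℝ^{n+1}. Suppose x ∈ ℝⁿ, w ∈ ℝ^m with w_1 + ⋯ + w_m = 1, and λ = (λ_1,…,λ_l) ∈ ℝ^l satisfy the stationarity equation w_1 ∇f_1(x) + ⋯ + w_m ∇f_m(x) = λ_1 ∇c_1(x) + ⋯ + λ_l ∇c_l(x). Then the m×m matrix DᵀD is invertible and w = (DᵀD)⁻¹ Dᵀ ( ĥ_1(x) + ĥ_2(x,λ) ), where ĥ_1(x) = (−∇h(x), 1) ∈ ℝ^{n+1} and ĥ_2(x,λ) = (λ_1 ∇c_1(x) + ⋯ + λ_l ∇c_l(x), 0) ∈ ℝ^{n+1}. -/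
open Matrix

theorem grad_add_linear {n : ℕ} {h : (Fin n → ℝ) → ℝ} {x : Fin n → ℝ}
    (hh : DifferentiableAt ℝ h x) (a : Fin n → ℝ) :
    grad (fun y => h y + ∑ k, a k * y k) x = grad h x + a := by
  have hlin : HasFDerivAt (fun y : Fin n → ℝ => ∑ k, a k * y k)
      (∑ k, a k • ContinuousLinearMap.proj (R := ℝ) (φ := fun _ : Fin n => ℝ) k) x :=
    HasFDerivAt.fun_sum fun k _ => (hasFDerivAt_apply k x).const_mul (a k)
  ext i
  have := (hh.hasFDerivAt.fun_add hlin).fderiv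
  simp [grad, this, Pi.single_apply]

theorem isUnit_transpose_mul_self_of_mulVec_injective {m n : Type*} [Fintype m] [Fintype n]
    [DecidableEq n] {A : Matrix m n ℝ} (hA : Function.Injective A.mulVec) :
    IsUnit (Aᵀ * A) := by
  have hpos := Matrix.PosDef.conjTranspose_mul_self A hA
  rw [conjTranspose_eq_transpose_of_trivial] at hpos
  exact hpos.isUnit

/-- For objectives `f j = h + ⟨d j, ·⟩` with linearly independent `d j`, the weight
vector in the stationarity equation is determined by the formula
`w = (DᵀD)⁻¹ Dᵀ (ĥ₁(x) + ĥ₂(x, λ))`. -/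
theorem weight_vector_formula {n m l : ℕ}
    (h : (Fin n → ℝ) → ℝ) (hhd : Differentiable ℝ h)
    (d : Fin m → Fin n → ℝ) (hdli : LinearIndependent ℝ d)
    (f : Fin m → (Fin n → ℝ) → ℝ)
    (hfdef : ∀ j, f j = fun x => h x + ∑ k, d j k * x k)
    (c : Fin l → (Fin n → ℝ) → ℝ) (hcd : ∀ i, Differentiable ℝ (c i))
    (D : Matrix (Fin (n + 1)) (Fin m) ℝ)
    (hD : ∀ j, (fun i => D i j) = Fin.snoc (d j) 1)
    (x : Fin n → ℝ) (w : Fin m → ℝ) (hw1 : ∑ j, w j = 1)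
    (lam : Fin l → ℝ)
    (hstat : ∑ j, w j • grad (f j) x = ∑ i, lam i • grad (c i) x) :
    IsUnit (D.transpose * D) ∧
      w = (D.transpose * D)⁻¹ *ᵥ (D.transpose *ᵥ
        ((Fin.snoc (-(grad h x)) 1 : Fin (n + 1) → ℝ) +
         (Fin.snoc (∑ i, lam i • grad (c i) x) 0 : Fin (n + 1) → ℝ))) := by
  have hcast (j : Fin m) (i : Fin n) : D i.castSucc j = d j i := by
    simpa using congrFun (hD j) i.castSucc
  have hlast (j : Fin m) : D (Fin.last n) j = 1 := by
    simpa using congrFun (hD j) (Fin.last n)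
  have hinj : Function.Injective D.mulVec := by
    rw [Matrix.mulVec_injective_iff]
    refine LinearIndependent.of_comp (LinearMap.funLeft ℝ ℝ Fin.castSucc) ?_
    have hcomp : LinearMap.funLeft ℝ ℝ Fin.castSucc ∘ D.col = d := by
      ext j i
      exact hcast j i
    rwa [hcomp]
  have hunit := isUnit_transpose_mul_self_of_mulVec_injective hinj
  have hgrad (j : Fin m) : grad (f j) x = grad h x + d j := by
    rw [hfdef j, grad_add_linear (hhd x)]
  have hDw : D *ᵥ w = (Fin.snoc (-(grad h x)) 1 : Fin (n + 1) → ℝ) +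
      (Fin.snoc (∑ i, lam i • grad (c i) x) 0 : Fin (n + 1) → ℝ) := by
    rw [← hstat]
    ext i
    refine Fin.lastCases ?_ (fun i => ?_) i
    · simp [mulVec, dotProduct, hlast, hw1]
    · simp [mulVec, dotProduct, hcast, hgrad, Finset.sum_add_distrib, ← Finset.sum_mul, hw1,
        mul_comm]
  refine ⟨hunit, ?_⟩
  rw [← hDw, mulVec_mulVec, mulVec_mulVec, Matrix.mul_assoc,
    nonsing_inv_mul _ ((isUnit_iff_isUnit_det _).mp hunit), one_mulVec]
end
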